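/- Let φ be a monotonic nonessential enhancement of site percolation on the square lattice ℤ², let s ∈ [0,1], and let p ∈ (0, p_c]. If the limit ξ(p)⁻¹ = lim_{|x|→∞} (−log τ_p(x)/|x|) exists, then the corresponding limit lim_{|x|→∞} (−log τ_{p,s}(x)/|x|) for the enhanced process exists and equals ξ(p)⁻¹; i.e., the correlation lengths coincide: ξ(p,s) = ξ(p). -/

import Mathlib

open MeasureTheory Filter Set Topology
open scoped ENNReal

namespace PercEnh

/-- Sites of the lattice (vertex set `ℤ²`). -/
abbrev Site : Type := ℤ × ℤ

/-- A configuration: the set of open sites. -/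
abbrev Config : Type := Set Site

/-- Square-lattice (`ℤ²`-) adjacency: `‖x − y‖₁ = 1`. -/
def adjZ2 (x y : Site) : Prop := |x.1 - y.1| + |x.2 - y.2| = 1

/-- Matching (star) adjacency: `x ≠ y` and `‖x − y‖_∞ = 1`. -/
def adjStar (x y : Site) : Prop := x ≠ y ∧ max |x.1 - y.1| |x.2 - y.2| = 1

/-- Euclidean norm of a site. -/
noncomputable def siteNorm (x : Site) : ℝ := Real.sqrt ((x.1 : ℝ) ^ 2 + (x.2 : ℝ) ^ 2)

/-- Sites in the closed Euclidean ball of radius `r` centred at the origin. -/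
def siteBall (r : ℝ) : Set Site := {x | siteNorm x ≤ r}

/-- The shifted configuration `τ_x ω = {y − x : y ∈ ω}`. -/
def shiftConfig (x : Site) (ω : Config) : Config := {y | y + x ∈ ω}

/-- An enhancement function of (finite) range `R₀`: takes values in subsets of
`𝔹₀ = ℤ² ∩ B(R₀)` and depends only on the restriction of the configuration to `𝔹₀`. -/
def IsEnhancement (R₀ : ℝ) (φ : Config → Config) : Prop :=
  0 ≤ R₀ ∧ (∀ ω, φ ω ⊆ siteBall R₀) ∧
    ∀ ω ω' : Config, ω ∩ siteBall R₀ = ω' ∩ siteBall R₀ → φ ω = φ ω'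

/-- A monotonic enhancement function. -/
def Monotonic (φ : Config → Config) : Prop := ∀ ω ω' : Config, ω ⊆ ω' → φ ω ⊆ φ ω'

/-- The translate `φ_x(ω) = x + φ₀(τ_x ω)`. -/
def enhAt (φ : Config → Config) (x : Site) (ω : Config) : Config :=
  (fun z => z + x) '' φ (shiftConfig x ω)

/-- The enhanced configuration `ω̂(ω, α) = ω ∪ ⋃_{x : α(x)=1} φ_x(ω)`. -/
def enhanced (φ : Config → Config) (ω : Config) (α : Site → Bool) : Config :=
  ω ∪ {y | ∃ x, α x = true ∧ y ∈ enhAt φ x ω}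

/-- The fully (deterministically, with `s = 1`) enhanced configuration `ω̃`. -/
def fullyEnhanced (φ : Config → Config) (ω : Config) : Config :=
  ω ∪ {y | ∃ x, y ∈ enhAt φ x ω}

/-- `ω` contains a doubly-infinite self-repelling path (w.r.t. adjacency `adj`):
a two-sided sequence of distinct sites of `ω` in which exactly the consecutive
pairs are adjacent. -/
def HasDISRPath (adj : Site → Site → Prop) (ω : Config) : Prop :=
  ∃ γ : ℤ → Site, Function.Injective γ ∧ (∀ i, γ i ∈ ω) ∧
    ∀ i j : ℤ, adj (γ i) (γ j) ↔ (j = i + 1 ∨ i = j + 1)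

/-- The enhancement is essential: some configuration without a doubly-infinite
self-repelling path acquires one upon enhancement at the origin. -/
def Essential (adj : Site → Site → Prop) (φ : Config → Config) : Prop :=
  ∃ ω : Config, ¬ HasDISRPath adj ω ∧ HasDISRPath adj (ω ∪ φ ω)

/-- A (finite, nonempty) path w.r.t. adjacency `adj`: distinct sites,
consecutive ones adjacent. -/
def IsPathOn (adj : Site → Site → Prop) (l : List Site) : Prop :=
  l ≠ [] ∧ l.Nodup ∧ l.Chain' adj

/-- `x` and `y` are joined by a path of sites of `ω`. -/
def ConnectedIn (adj : Site → Site → Prop) (ω : Config) (x y : Site) : Prop :=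
  ∃ l : List Site, IsPathOn adj l ∧ (∀ z ∈ l, z ∈ ω) ∧
    l.head? = some x ∧ l.getLast? = some y

/-- `x` belongs to an infinite open cluster of `ω`. -/
def InInfiniteCluster (adj : Site → Site → Prop) (ω : Config) (x : Site) : Prop :=
  {y | ConnectedIn adj ω x y}.Infinite

/-- `ω` contains an infinite open cluster. -/
def HasInfiniteCluster (adj : Site → Site → Prop) (ω : Config) : Prop :=
  ∃ x, InInfiniteCluster adj ω x

/-- The configuration corresponding to `η : Site → Bool`. -/
def toConfig (η : Site → Bool) : Config := {x | η x = true}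

/-- A cylinder event. -/
def cylinder (F : Finset Site) (b : Site → Bool) : Set (Site → Bool) :=
  {η | ∀ x ∈ F, η x = b x}

/-- `μ` is the Bernoulli product measure with density `p` of open sites. -/
def IsBernoulli (p : ℝ) (μ : Measure (Site → Bool)) : Prop :=
  IsProbabilityMeasure μ ∧
    ∀ (F : Finset Site) (b : Site → Bool),
      μ (cylinder F b) = ∏ x ∈ F, ENNReal.ofReal (if b x then p else 1 - p)

/-- The percolation probability `θ`: the probability that the origin lies in an
infinite open cluster. -/
noncomputable def theta (adj : Site → Site → Prop) (μ : Measure (Site → Bool)) : ℝ :=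
  (μ {η | InInfiniteCluster adj (toConfig η) 0}).toReal

/-- The percolation probability of the enhanced process (`μ` the law of the
configuration, `ν` the law of the activation variables). -/
noncomputable def thetaEnh (adj : Site → Site → Prop) (φ : Config → Config)
    (μ ν : Measure (Site → Bool)) : ℝ :=
  ((μ.prod ν) {ηα | InInfiniteCluster adj (enhanced φ (toConfig ηα.1) ηα.2) 0}).toReal

/-- The critical point `p_c = sup {p ∈ [0,1] : θ(p) = 0}` for the family `P`. -/
noncomputable def pcOf (adj : Site → Site → Prop) (P : ℝ → Measure (Site → Bool)) : ℝ :=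
  sSup {p | p ∈ Icc (0:ℝ) 1 ∧ theta adj (P p) = 0}

/-- The connectivity function `τ_p(x)`. -/
noncomputable def tau (adj : Site → Site → Prop) (μ : Measure (Site → Bool)) (x : Site) : ℝ :=
  (μ {η | ConnectedIn adj (toConfig η) 0 x}).toReal

/-- The connectivity function `τ_{p,s}(x)` of the enhanced process. -/
noncomputable def tauEnh (adj : Site → Site → Prop) (φ : Config → Config)
    (μ ν : Measure (Site → Bool)) (x : Site) : ℝ :=
  ((μ.prod ν) {ηα | ConnectedIn adj (enhanced φ (toConfig ηα.1) ηα.2) 0 x}).toReal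

/-- The mean cluster size `χ(p) = E_p‖C‖ = ∑_x τ_p(x)`. -/
noncomputable def chi (adj : Site → Site → Prop) (μ : Measure (Site → Bool)) : ℝ≥0∞ :=
  ∑' x : Site, μ {η | ConnectedIn adj (toConfig η) 0 x}

/-- The mean cluster size of the enhanced process. -/
noncomputable def chiEnh (adj : Site → Site → Prop) (φ : Config → Config)
    (μ ν : Measure (Site → Bool)) : ℝ≥0∞ :=
  ∑' x : Site, (μ.prod ν) {ηα | ConnectedIn adj (enhanced φ (toConfig ηα.1) ηα.2) 0 x}


lemma adjZ2.symm {v w : Site} (h : adjZ2 v w) : adjZ2 w v := by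
  unfold adjZ2 at *
  rw [abs_sub_comm w.1, abs_sub_comm w.2]
  exact h

/-- The graph on `ℤ²` whose edges are the lattice edges with both ends in `S`. -/
def openGraph (S : Set Site) : SimpleGraph Site where
  Adj v w := adjZ2 v w ∧ v ∈ S ∧ w ∈ S
  symm := ⟨fun _ _ h => ⟨h.1.symm, h.2.2, h.2.1⟩⟩
  loopless := ⟨by
    rintro v ⟨h, -⟩
    simp [adjZ2] at h⟩

lemma openGraph_mono {S T : Set Site} (h : S ⊆ T) : openGraph S ≤ openGraph T :=
  fun _ _ hvw => ⟨hvw.1, h hvw.2.1, h hvw.2.2⟩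

lemma mem_of_reachable {S : Set Site} {v w : Site} (h : (openGraph S).Reachable v w)
    (hv : v ∈ S) : w ∈ S := by
  rw [SimpleGraph.reachable_iff_reflTransGen] at h
  induction h with
  | refl => exact hv
  | tail _ h _ => exact h.2.2

lemma connectedIn_of_reachable {S : Set Site} {v w : Site} (h : (openGraph S).Reachable v w)
    (hv : v ∈ S) : ConnectedIn adjZ2 S v w := by
  classical
  obtain ⟨p, hp⟩ := h.exists_isPath
  refine ⟨p.support, ⟨p.support_ne_nil, hp.support_nodup, ?_⟩, ?_, ?_, ?_⟩
  · exact p.isChain_adj_support.imp fun _ _ h => h.1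
  · intro z hz
    exact mem_of_reachable ⟨p.takeUntil z hz⟩ hv
  · rw [List.head?_eq_some_head p.support_ne_nil, SimpleGraph.Walk.head_support]
  · rw [List.getLast?_eq_some_getLast p.support_ne_nil, SimpleGraph.Walk.getLast_support]

lemma ConnectedIn.reachable {S : Set Site} {v w : Site} (h : ConnectedIn adjZ2 S v w) :
    v ∈ S ∧ (openGraph S).Reachable v w := by
  obtain ⟨l, ⟨-, -, hc⟩, hS, hv, hw⟩ := h
  induction l generalizing v with
  | nil => simp at hv
  | cons c l ih =>
    obtain rfl : c = v := by simpa using hv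
    refine ⟨hS c (by simp), ?_⟩
    cases l with
    | nil =>
      obtain rfl : c = w := by simpa using hw
      exact SimpleGraph.Reachable.refl _
    | cons d l =>
      replace hc := List.isChain_cons_cons.1 hc
      have := ih (v := d) hc.2 (fun z hz => hS z (List.mem_cons_of_mem _ hz)) rfl
        (by simpa using hw)
      have hadj : (openGraph S).Adj c d := ⟨hc.1, hS c (by simp), this.1⟩
      exact hadj.reachable.trans this.2

lemma HasDISRPath.mono {adj : Site → Site → Prop} {ω ω' : Config} (h : ω ⊆ ω')
    (hω : HasDISRPath adj ω) : HasDISRPath adj ω' := by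
  obtain ⟨γ, h1, h2, h3⟩ := hω
  exact ⟨γ, h1, fun i => h (h2 i), h3⟩

lemma adjZ2_add_right {v w x : Site} : adjZ2 (v + x) (w + x) ↔ adjZ2 v w := by
  simp [adjZ2]

lemma hasDISRPath_shiftConfig {x : Site} {ω : Config} :
    HasDISRPath adjZ2 (shiftConfig x ω) ↔ HasDISRPath adjZ2 ω := by
  constructor
  · rintro ⟨γ, h1, h2, h3⟩
    exact ⟨fun i => γ i + x, fun i j h => h1 (add_right_cancel h), h2,
      fun i j => adjZ2_add_right.trans (h3 i j)⟩
  · rintro ⟨γ, h1, h2, h3⟩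
    refine ⟨fun i => γ i - x, fun i j h => h1 (sub_left_injective h), fun i => ?_, fun i j => ?_⟩
    · simpa [shiftConfig] using h2 i
    · simpa [adjZ2] using h3 i j

lemma enhAt_mono {φ : Config → Config} (hmono : Monotonic φ) (x : Site) {ω ω' : Config}
    (h : ω ⊆ ω') : enhAt φ x ω ⊆ enhAt φ x ω' :=
  image_mono (hmono _ _ fun _ hy => h hy)

/-- A nonessential enhancement at an arbitrary site creates no doubly-infinite path. -/
lemma hasDISRPath_of_union_enhAt {φ : Config → Config} (hness : ¬ Essential adjZ2 φ)
    {x : Site} {ω : Config} (h : HasDISRPath adjZ2 (ω ∪ enhAt φ x ω)) :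
    HasDISRPath adjZ2 ω := by
  by_contra hω
  refine hness ⟨shiftConfig x ω, by rwa [hasDISRPath_shiftConfig], ?_⟩
  rw [← hasDISRPath_shiftConfig (x := x)] at h
  refine h.mono ?_
  rintro y (hy | ⟨z, hz, hzy⟩)
  · exact Or.inl hy
  · obtain rfl : z = y := add_right_cancel hzy
    exact Or.inr hz

/-- A monotonic nonessential enhancement at finitely many sites creates no doubly-infinite path. -/
lemma hasDISRPath_of_union_biUnion_enhAt {φ : Config → Config} (hmono : Monotonic φ)
    (hness : ¬ Essential adjZ2 φ) {X : Set Site} (hX : X.Finite) {ω : Config}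
    (h : HasDISRPath adjZ2 (ω ∪ ⋃ x ∈ X, enhAt φ x ω)) : HasDISRPath adjZ2 ω := by
  induction X, hX using Set.Finite.induction_on with
  | empty => simpa using h
  | @insert x X _ _ ih =>
    refine ih (hasDISRPath_of_union_enhAt hness (x := x) (h.mono ?_))
    rw [biUnion_insert]
    have := enhAt_mono hmono x (subset_union_left : ω ⊆ ω ∪ ⋃ x ∈ X, enhAt φ x ω)
    grind

/-- The scalar product on `ℤ²`. -/
def lin (u w : Site) : ℤ := u.1 * w.1 + u.2 * w.2

/-- `e` is the unit lattice vector that strictly maximises the scalar product with `u`. -/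
structure Dominates (u e : Site) : Prop where
  unit : |e.1| + |e.2| = 1
  lt : ∀ d : Site, |d.1| + |d.2| = 1 → d ≠ e → lin u d < lin u e

lemma lin_add (u v w : Site) : lin u (v + w) = lin u v + lin u w := by
  simp [lin]; ring

lemma lin_sub (u v w : Site) : lin u (v - w) = lin u v - lin u w := by
  simp [lin]; ring

lemma lin_smul (u w : Site) (k : ℤ) : lin u (k • w) = k * lin u w := by
  simp [lin]; ring

namespace Dominates

variable {u e : Site}

lemma pos (h : Dominates u e) : 0 < lin u e := by
  have h1 := h.lt (-e) (by simpa using h.unit) (by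
    intro h2
    have h3 := h.unit
    have h4 : -e.1 = e.1 := congrArg Prod.fst h2
    have h5 : -e.2 = e.2 := congrArg Prod.snd h2
    rw [show e.1 = 0 by omega, show e.2 = 0 by omega] at h3
    simp at h3)
  simp only [lin, Prod.fst_neg, Prod.snd_neg] at h1 ⊢
  linarith

lemma neg (h : Dominates u e) : Dominates (-u) (-e) := by
  refine ⟨by simpa using h.unit, fun d hd hne => ?_⟩
  have := h.lt (-d) (by simpa using hd) (by rintro rfl; simp at hne)
  simp only [lin, Prod.fst_neg, Prod.snd_neg] at this ⊢
  linarith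

lemma le (h : Dominates u e) {d : Site} (hd : |d.1| + |d.2| = 1) : lin u d ≤ lin u e := by
  by_cases hde : d = e
  · rw [hde]
  · exact (h.lt d hd hde).le

lemma adj_le (h : Dominates u e) {v w : Site} (hvw : adjZ2 v w) :
    lin u v ≤ lin u w + lin u e := by
  have := h.le (d := v - w) hvw
  rw [lin_sub] at this
  linarith

lemma adj_eq (h : Dominates u e) {v w : Site} (hvw : adjZ2 v w)
    (hle : lin u w + lin u e ≤ lin u v) : v = w + e := by
  by_contra hne
  have := h.lt (v - w) hvw (by rintro rfl; simp at hne)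
  rw [lin_sub] at this
  linarith

lemma abs_fst_le (h : Dominates u e) : |u.1| ≤ lin u e := by
  have h1 := h.le (d := (1, 0)) (by simp)
  have h2 := h.le (d := (-1, 0)) (by simp)
  rw [abs_le]
  simp only [lin] at *
  constructor <;> linarith

lemma abs_snd_le (h : Dominates u e) : |u.2| ≤ lin u e := by
  have h1 := h.le (d := (0, 1)) (by simp)
  have h2 := h.le (d := (0, -1)) (by simp)
  rw [abs_le]
  simp only [lin] at *
  constructor <;> linarith

end Dominates

/-- The lattice ray from `a` in direction `e`. -/
def ray (a e : Site) : Set Site := {v | ∃ k : ℤ, 0 ≤ k ∧ v = a + k • e}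

lemma adjZ2_line {e : Site} (he : |e.1| + |e.2| = 1) (a : Site) (i j : ℤ) :
    adjZ2 (a + i • e) (a + j • e) ↔ |i - j| = 1 := by
  have : |(a + i • e).1 - (a + j • e).1| + |(a + i • e).2 - (a + j • e).2| = |i - j| := by
    rw [← mul_one |i - j|, ← he, mul_add, ← abs_mul, ← abs_mul]
    congr 2 <;> simp <;> ring
  rw [adjZ2, this]

lemma line_injective {e : Site} (he : |e.1| + |e.2| = 1) (a : Site) {i j : ℤ}
    (h : a + i • e = a + j • e) : i = j := by
  have h1 : (i - j) • e = 0 := by rw [sub_smul, add_left_cancel h, sub_self]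
  rcases smul_eq_zero.1 h1 with h2 | rfl
  · omega
  · simp at he

/-- A connected set between two opposite rays contains, with the rays, a doubly-infinite
self-repelling path. -/
lemma hasDISRPath_of_reachable {T : Set Site} {u e a b : Site} (hd : Dominates u e) (ha : a ∈ T)
    (hab : (openGraph T).Reachable a b)
    (hmin : ∀ v, (openGraph T).Reachable a v → lin u a ≤ lin u v)
    (hmax : ∀ v, (openGraph T).Reachable a v → lin u v ≤ lin u b)
    (hlt : lin u a + lin u e < lin u b) :
    HasDISRPath adjZ2 ({v | (openGraph T).Reachable a v} ∪ (ray a (-e) ∪ ray b e)) := by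
  have hpos := hd.pos
  obtain ⟨p, hp⟩ := hab.exists_walk_length_eq_dist
  set n := p.length with hn
  have hreach : ∀ i, (openGraph T).Reachable a (p.getVert i) := fun i => ⟨p.take i⟩
  have hdist : ∀ i ≤ n, (openGraph T).dist a (p.getVert i) = i := by
    intro i hi
    have h1 : (openGraph T).dist a (p.getVert i) ≤ i := by
      refine (SimpleGraph.dist_le (p.take i)).trans ?_
      simp [SimpleGraph.Walk.take_length]
    have h2 : (openGraph T).dist (p.getVert i) b ≤ n - i := by
      refine (SimpleGraph.dist_le (p.drop i)).trans ?_
      simp [SimpleGraph.Walk.drop_length, hn]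
    have h3 : (openGraph T).dist a b ≤
        (openGraph T).dist a (p.getVert i) + (openGraph T).dist (p.getVert i) b := by
      obtain ⟨q, hq⟩ := (hreach i).exists_walk_length_eq_dist
      obtain ⟨r, hr⟩ := ((hreach i).symm.trans hab).exists_walk_length_eq_dist
      rw [← hq, ← hr, ← SimpleGraph.Walk.length_append]
      exact SimpleGraph.dist_le _
    omega
  have hnpos : 0 < n := by
    rcases Nat.eq_zero_or_pos n with h | h
    · have := SimpleGraph.Walk.eq_of_length_eq_zero (p := p) (hn ▸ h)
      subst this
      linarith
    · exact h
  have hinj : ∀ i ≤ n, ∀ j ≤ n, p.getVert i = p.getVert j → i = j := by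
    intro i hi j hj hij
    rw [← hdist i hi, ← hdist j hj, hij]
  set γ : ℤ → Site := fun i =>
    if i ≤ 0 then a + i • e else if i ≤ n then p.getVert i.toNat else b + (i - n) • e with hγ
  have hγneg : ∀ i ≤ 0, γ i = a + i • e := fun i hi => by simp [hγ, hi]
  have hγmid : ∀ i : ℕ, i ≤ n → γ i = p.getVert i := by
    intro i hi
    rcases Nat.eq_zero_or_pos i with rfl | h
    · simp [hγ]
    · simp [hγ, hi, h.ne']
  have hγpos : ∀ i : ℤ, n ≤ i → γ i = b + (i - n) • e := by
    intro i hi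
    rcases hi.eq_or_lt with rfl | h
    · rw [hγmid n le_rfl]
      simp [hn]
    · simp [hγ, h.not_ge, show ¬ i ≤ 0 by omega]
  have hγge : ∀ i : ℤ, 0 < i → lin u a ≤ lin u (γ i) := by
    intro i hi
    rcases le_total i n with h | h
    · lift i to ℕ using hi.le
      rw [hγmid i (by omega)]
      exact hmin _ (hreach i)
    · rw [hγpos i h, lin_add, lin_smul]
      have : 0 ≤ (i - n) * lin u e := mul_nonneg (by omega) hpos.le
      linarith
  have hγle : ∀ i : ℤ, i < n → lin u (γ i) ≤ lin u b := by
    intro i hi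
    rcases le_total i 0 with h | h
    · rw [hγneg i h, lin_add, lin_smul]
      have : i * lin u e ≤ 0 := mul_nonpos_of_nonpos_of_nonneg h hpos.le
      linarith
    · lift i to ℕ using h
      rw [hγmid i (by omega)]
      exact hmax _ (hreach i)
  have key : ∀ i j : ℤ, i < j → γ i ≠ γ j ∧ (adjZ2 (γ i) (γ j) ↔ j = i + 1) := by
    intro i j hij
    rcases le_or_gt j 0 with hj | hj
    · rw [hγneg i (by omega), hγneg j hj, adjZ2_line hd.unit]
      refine ⟨fun h => hij.ne (line_injective hd.unit a h), ?_⟩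
      rw [abs_sub_comm, abs_of_pos (by omega)]
      omega
    rcases le_or_gt (n : ℤ) i with hi | hi
    · rw [hγpos i hi, hγpos j (by omega), adjZ2_line hd.unit]
      refine ⟨fun h => hij.ne (by have := line_injective hd.unit b h; omega), ?_⟩
      rw [abs_sub_comm, abs_of_pos (by omega)]
      omega
    rcases le_or_gt 0 i with hi0 | hi0
    · rcases le_or_gt j n with hjn | hjn
      · lift i to ℕ using hi0
        lift j to ℕ using hj.le
        have hi' : i ≤ n := by omega
        have hj' : j ≤ n := by omega
        rw [hγmid i hi', hγmid j hj']
        refine ⟨fun h => by have := hinj i hi' j hj' h; omega, fun h => ?_, fun h => ?_⟩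
        · have hadj : (openGraph T).Adj (p.getVert i) (p.getVert j) :=
            ⟨h, mem_of_reachable (hreach i) ha, mem_of_reachable (hreach j) ha⟩
          obtain ⟨q, hq⟩ := (hreach i).exists_walk_length_eq_dist
          have h1 := SimpleGraph.dist_le (q.append hadj.toWalk)
          rw [SimpleGraph.Walk.length_append, hq, hdist i hi', hdist j hj'] at h1
          simp at h1
          omega
        · obtain rfl : j = i + 1 := by omega
          exact (p.adj_getVert_succ (by omega)).1
      · have h1 := hγle i hi
        have h2 : lin u b + lin u e ≤ lin u (γ j) := by
          rw [hγpos j hjn.le, lin_add, lin_smul]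
          have : 1 * lin u e ≤ (j - n) * lin u e :=
            mul_le_mul_of_nonneg_right (by omega) hpos.le
          linarith
        refine ⟨fun h => by rw [h] at h1; linarith, fun h => ?_, fun h => ?_⟩
        · have h3 := hd.adj_eq h.symm (by linarith)
          rw [hγpos j hjn.le] at h3
          have h4 : lin u (γ i) = lin u b + (j - n - 1) * lin u e := by
            have := congrArg (lin u) h3
            simp only [lin_add, lin_smul] at this
            linarith
          have h5 : j - n - 1 ≤ 0 := by
            by_contra hc
            have : 0 < (j - n - 1) * lin u e := mul_pos (by omega) hpos
            linarith
          have h6 : j = n + 1 := by omega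
          subst h6
          have h7 : γ i = b := by simpa using h3.symm
          lift i to ℕ using hi0
          rw [hγmid i (by omega)] at h7
          have := hinj i (by omega) n le_rfl (by rw [h7, hn, p.getVert_length])
          omega
        · omega
    · have h1 := hγge j hj
      have h2 : lin u (γ i) + lin u e ≤ lin u a := by
        rw [hγneg i hi0.le, lin_add, lin_smul]
        have : i * lin u e ≤ (-1) * lin u e :=
          mul_le_mul_of_nonneg_right (by omega) hpos.le
        linarith
      refine ⟨fun h => by rw [h] at h2; linarith, fun h => ?_, fun h => ?_⟩
      · have h3 := hd.adj_eq h.symm (by linarith)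
        have h4 := hd.adj_le h.symm
        have h5 : γ i = a - e := by
          rw [hγneg i hi0.le] at h4 ⊢
          have h6 : -1 ≤ i := by
            by_contra hc
            rw [lin_add, lin_smul] at h4
            have : (i + 1) * lin u e < 0 := mul_neg_of_neg_of_pos (by omega) hpos
            linarith
          obtain rfl : i = -1 := by omega
          simp [sub_eq_add_neg]
        have h6 : γ j = a := by rw [h3, h5, sub_add_cancel]
        rcases le_or_gt j n with hjn | hjn
        · lift j to ℕ using hj.le
          rw [hγmid j (by omega)] at h6
          have := hinj j (by omega) 0 (by omega) (by rw [h6, p.getVert_zero])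
          omega
        · have h7 : lin u b ≤ lin u (γ j) := by
            rw [hγpos j hjn.le, lin_add, lin_smul]
            have : 0 ≤ (j - n) * lin u e := mul_nonneg (by omega) hpos.le
            linarith
          rw [h6] at h7
          linarith
      · omega
  refine ⟨γ, fun i j h => ?_, fun i => ?_, fun i j => ?_⟩
  · rcases lt_trichotomy i j with hij | hij | hij
    · exact absurd h (key i j hij).1
    · exact hij
    · exact absurd h.symm (key j i hij).1
  · rcases le_or_gt i 0 with h | h
    · exact Or.inr (Or.inl ⟨-i, by omega, by rw [hγneg i h]; simp⟩)
    rcases le_or_gt i n with h' | h'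
    · lift i to ℕ using h.le
      rw [hγmid i (by omega)]
      exact Or.inl (hreach i)
    · exact Or.inr (Or.inr ⟨i - n, by omega, hγpos i h'.le⟩)
  · rcases lt_trichotomy i j with hij | rfl | hij
    · rw [(key i j hij).2]
      omega
    · simp [adjZ2]
    · rw [← (key j i hij).2.trans (by omega : i = j + 1 ↔ (j = i + 1 ∨ i = j + 1))]
      exact ⟨adjZ2.symm, adjZ2.symm⟩

/-- A path from `A` to `B` in `F ∪ (A ∪ B)` has a stretch in `F` joining a neighbour of `A` to a
neighbour of `B`. -/
lemma exists_crossing {F A B : Set Site} (hdisj : Disjoint A B)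
    (hAB : ∀ v ∈ A, ∀ w ∈ B, ¬ adjZ2 v w) {g : ℕ → Site}
    (hg : ∀ n, adjZ2 (g n) (g (n + 1))) (hmem : ∀ n, g n ∈ F ∪ (A ∪ B))
    (h0 : g 0 ∈ A) {n : ℕ} (hn : g n ∈ B) :
    ∃ y ∈ F, ∃ z ∈ F, (openGraph F).Reachable y z ∧
      (∃ v ∈ A, adjZ2 v y) ∧ ∃ w ∈ B, adjZ2 w z := by
  by_contra hcon
  have key : ∀ m, g m ∈ A ∨ (g m ∉ B ∧ g m ∈ F ∧
      ∃ y ∈ F, (openGraph F).Reachable y (g m) ∧ ∃ v ∈ A, adjZ2 v y) := by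
    intro m
    induction m with
    | zero => exact Or.inl h0
    | succ m ih =>
      by_cases hA : g (m + 1) ∈ A
      · exact Or.inl hA
      right
      rcases ih with h | ⟨-, hF, y, hy, hr, hv⟩
      · have hB : g (m + 1) ∉ B := fun hB => hAB _ h _ hB (hg m)
        have hF : g (m + 1) ∈ F := by
          rcases hmem (m + 1) with h | h | h
          exacts [h, absurd h hA, absurd h hB]
        exact ⟨hB, hF, _, hF, SimpleGraph.Reachable.refl _, _, h, hg m⟩
      · have hB : g (m + 1) ∉ B :=
          fun hB => hcon ⟨y, hy, g m, hF, hr, hv, _, hB, (hg m).symm⟩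
        have hF' : g (m + 1) ∈ F := by
          rcases hmem (m + 1) with h | h | h
          exacts [h, absurd h hA, absurd h hB]
        have hadj : (openGraph F).Adj (g m) (g (m + 1)) := ⟨hg m, hF, hF'⟩
        exact ⟨hB, hF', y, hy, hr.trans hadj.reachable, hv⟩
  rcases key n with h | h
  · exact hdisj.le_bot ⟨h, hn⟩
  · exact h.1 hn

/-- An injective path in a ray visits all sufficiently distant sites of the ray. -/
lemma exists_eq_of_mem_ray {a e : Site} (he : |e.1| + |e.2| = 1) {g : ℕ → Site}
    (hinj : Function.Injective g) (hg : ∀ n, adjZ2 (g n) (g (n + 1)))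
    (hmem : ∀ n, g n ∈ ray a e) : ∃ K : ℤ, ∀ k ≥ K, ∃ n, g n = a + k • e := by
  choose κ hκ0 hκ using hmem
  have hstep : ∀ n, |κ n - κ (n + 1)| = 1 := by
    intro n
    rw [← adjZ2_line he a, ← hκ, ← hκ]
    exact hg n
  refine ⟨κ 0, fun k hk => ?_⟩
  have hunb : ∃ n, k ≤ κ n := by
    by_contra! hcon
    have hfin : (Set.range κ).Finite :=
      (Set.finite_Icc (0 : ℤ) k).subset (by rintro _ ⟨n, rfl⟩; exact ⟨hκ0 n, (hcon n).le⟩)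
    refine Set.infinite_range_of_injective (f := κ) (fun m n hmn => hinj ?_) hfin
    rw [hκ m, hκ n, hmn]
  classical
  obtain ⟨n, hn, hmin⟩ : ∃ n, k ≤ κ n ∧ ∀ m < n, κ m < k :=
    ⟨Nat.find hunb, Nat.find_spec hunb, fun m hm => not_le.1 (Nat.find_min hunb hm)⟩
  refine ⟨n, ?_⟩
  have : κ n = k := by
    cases n with
    | zero => omega
    | succ n =>
      have h1 := hmin n (by omega)
      have h2 := (abs_eq (by omega)).1 (hstep n)
      omega
  rw [hκ n, this]

/-- A doubly-infinite self-repelling path in the union of a finite set and two rays connects the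
rays through the finite set. -/
lemma exists_crossing_of_hasDISRPath {F : Set Site} (hF : F.Finite) {a e b e' : Site}
    (he : |e.1| + |e.2| = 1) (he' : |e'.1| + |e'.2| = 1)
    (hdisj : Disjoint (ray a e) (ray b e'))
    (hAB : ∀ v ∈ ray a e, ∀ w ∈ ray b e', ¬ adjZ2 v w)
    (h : HasDISRPath adjZ2 (F ∪ (ray a e ∪ ray b e'))) :
    ∃ y ∈ F, ∃ z ∈ F, (openGraph F).Reachable y z ∧
      (∃ v ∈ ray a e, adjZ2 v y) ∧ ∃ w ∈ ray b e', adjZ2 w z := by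
  obtain ⟨γ, hinj, hmem, hadj⟩ := h
  obtain ⟨M, hM⟩ : ∃ M : ℕ, ∀ i : ℤ, γ i ∈ F → |i| ≤ M := by
    have hfin : (γ ⁻¹' F).Finite := hF.preimage hinj.injOn
    obtain ⟨M, hM⟩ := (hfin.image fun i => i.natAbs).bddAbove
    refine ⟨M, fun i hi => ?_⟩
    have := hM ⟨i, hi, rfl⟩
    rw [Int.abs_eq_natAbs]
    exact_mod_cast this
  have tail : ∀ g : ℕ → Site, (∀ n, adjZ2 (g n) (g (n + 1))) →
      (∀ n, g n ∈ ray a e ∪ ray b e') → (∀ n, g n ∈ ray a e) ∨ ∀ n, g n ∈ ray b e' := by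
    intro g hg hgm
    rcases hgm 0 with h0 | h0
    · left
      intro n
      induction n with
      | zero => exact h0
      | succ n ih => exact (hgm (n + 1)).resolve_right fun h => hAB _ ih _ h (hg n)
    · right
      intro n
      induction n with
      | zero => exact h0
      | succ n ih => exact (hgm (n + 1)).resolve_left fun h => hAB _ h _ ih (hg n).symm
  set r : ℕ → Site := fun n => γ (M + 1 + n) with hr
  set l : ℕ → Site := fun n => γ (-(M + 1 + n)) with hl
  have hrl : ∀ m n, r m ≠ l n := fun m n hmn => by have := hinj hmn; omega
  have hri : Function.Injective r := fun m n hmn => by have := hinj hmn; omega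
  have hli : Function.Injective l := fun m n hmn => by have := hinj hmn; omega
  have hra : ∀ n, adjZ2 (r n) (r (n + 1)) := fun n => (hadj _ _).2 (by push_cast; omega)
  have hla : ∀ n, adjZ2 (l n) (l (n + 1)) := fun n => (hadj _ _).2 (by push_cast; omega)
  have hrm : ∀ n, r n ∈ ray a e ∪ ray b e' := fun n =>
    (hmem _).resolve_left fun h => by have := hM _ h; rw [abs_le] at this; omega
  have hlm : ∀ n, l n ∈ ray a e ∪ ray b e' := fun n =>
    (hmem _).resolve_left fun h => by have := hM _ h; rw [abs_le] at this; omega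
  have same : ∀ c d : Site, |d.1| + |d.2| = 1 → (∀ n, r n ∈ ray c d) →
      (∀ n, l n ∈ ray c d) → False := by
    intro c d hd h1 h2
    obtain ⟨K, hK⟩ := exists_eq_of_mem_ray hd hri hra h1
    obtain ⟨K', hK'⟩ := exists_eq_of_mem_ray hd hli hla h2
    obtain ⟨m, hm⟩ := hK (max K K') (le_max_left _ _)
    obtain ⟨n, hn⟩ := hK' (max K K') (le_max_right _ _)
    exact hrl m n (hm.trans hn.symm)
  rcases tail r hra hrm with h1 | h1 <;> rcases tail l hla hlm with h2 | h2
  · exact (same a e he h1 h2).elim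
  · refine exists_crossing hdisj hAB (g := fun n => γ (M + 1 - n)) (n := 2 * (M + 1))
      (fun n => (hadj _ _).2 (by push_cast; omega)) (fun n => hmem _) ?_ ?_
    · simpa [hr] using h1 0
    · convert h2 0 using 2
      push_cast
      ring
  · refine exists_crossing hdisj hAB (g := fun n => γ (-(M + 1) + n)) (n := 2 * (M + 1))
      (fun n => (hadj _ _).2 (by push_cast; omega)) (fun n => hmem _) ?_ ?_
    · simpa [hl] using h2 0
    · convert h1 0 using 2
      push_cast
      ring
  · exact (same b e' he' h1 h2).elim

/-- The sites within sup-norm distance `r` of `S`. -/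
def thicken (r : ℤ) (S : Set Site) : Set Site :=
  {w | ∃ v ∈ S, |w.1 - v.1| ≤ r ∧ |w.2 - v.2| ≤ r}

lemma finite_thicken {S : Set Site} (hS : S.Finite) (r : ℤ) : (thicken r S).Finite := by
  refine (hS.biUnion fun v _ =>
    (Set.finite_Icc (v.1 - r) (v.1 + r)).prod (Set.finite_Icc (v.2 - r) (v.2 + r))).subset ?_
  rintro w ⟨v, hv, h1, h2⟩
  rw [abs_le] at h1 h2
  refine mem_biUnion hv ⟨⟨?_, ?_⟩, ?_, ?_⟩ <;> omega

lemma lin_lt_of_mem_ray {u e a b : Site} (hd : Dominates u e)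
    (hlt : lin u a + lin u e < lin u b) {v w : Site} (hv : v ∈ ray a (-e)) (hw : w ∈ ray b e) :
    lin u v + lin u e < lin u w := by
  obtain ⟨k, hk, rfl⟩ := hv
  obtain ⟨j, hj, rfl⟩ := hw
  rw [lin_add, lin_add, lin_smul, lin_smul]
  have h1 : lin u (-e) = -lin u e := by simp [lin]; ring
  rw [h1]
  have h2 := mul_nonneg hk hd.pos.le
  have h3 := mul_nonneg hj hd.pos.le
  linarith

/-- Sites above the start of a dominated ray, up to a bounded error, and adjacent to the ray are
close to its start. -/
lemma close_of_adj_ray {u e a y : Site} (hd : Dominates u e) {S : Set Site} {r : ℤ}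
    (hS : ∀ v ∈ S, lin u a ≤ lin u v) (hy : y ∈ thicken r S)
    (hv : ∃ v ∈ ray a (-e), adjZ2 v y) :
    |y.1 - a.1| ≤ 2 * r + 2 ∧ |y.2 - a.2| ≤ 2 * r + 2 := by
  obtain ⟨_, ⟨k, hk, rfl⟩, hadj⟩ := hv
  obtain ⟨v, hv, h1, h2⟩ := hy
  have hpos := hd.pos
  have hr : 0 ≤ r := (abs_nonneg _).trans h1
  have hyv : lin u v - 2 * r * lin u e ≤ lin u y := by
    have h3 : |lin u (y - v)| ≤ lin u e * r + lin u e * r := by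
      refine (abs_add_le _ _).trans ?_
      rw [abs_mul, abs_mul]
      exact add_le_add (mul_le_mul hd.abs_fst_le h1 (abs_nonneg _) hpos.le)
        (mul_le_mul hd.abs_snd_le h2 (abs_nonneg _) hpos.le)
    have h4 := (abs_le.1 h3).1
    rw [lin_sub] at h4
    linarith
  have hle := hd.adj_le hadj.symm
  have hlin : lin u (a + k • -e) = lin u a - k * lin u e := by simp [lin]; ring
  rw [hlin] at hle
  have hk' : k ≤ 2 * r + 1 := by
    by_contra! hc
    have h3 : (2 * r + 1) * lin u e < k * lin u e := mul_lt_mul_of_pos_right hc hpos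
    have := hS v hv
    linarith
  have hunit := hd.unit
  have he1 : |e.1| ≤ 1 := by linarith [abs_nonneg e.2]
  have he2 : |e.2| ≤ 1 := by linarith [abs_nonneg e.1]
  have hke1 : |k * e.1| ≤ k := by
    rw [abs_mul, abs_of_nonneg hk]
    exact mul_le_of_le_one_right hk he1
  have hke2 : |k * e.2| ≤ k := by
    rw [abs_mul, abs_of_nonneg hk]
    exact mul_le_of_le_one_right hk he2
  simp only [adjZ2, Prod.fst_add, Prod.snd_add, Prod.smul_fst, Prod.smul_snd, smul_eq_mul,
    Prod.fst_neg, Prod.snd_neg, mul_neg] at hadj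
  have hc1 : |a.1 + -(k * e.1) - y.1| ≤ 1 := by
    linarith [abs_nonneg (a.2 + -(k * e.2) - y.2)]
  have hc2 : |a.2 + -(k * e.2) - y.2| ≤ 1 := by
    linarith [abs_nonneg (a.1 + -(k * e.1) - y.1)]
  rw [abs_le] at hc1 hc2 hke1 hke2 h1 h2 ⊢
  rw [abs_le]
  constructor <;> constructor <;> linarith

/-- If the enhanced configuration contains a finite connected set whose extremes in some direction
are `a` and `b`, then the original configuration joins the vicinities of `a` and `b`. -/
lemma exists_connectedIn_near {φ : Config → Config} {R₀ : ℝ} (hφ : IsEnhancement R₀ φ)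
    (hmono : Monotonic φ) (hness : ¬ Essential adjZ2 φ) {R : ℤ}
    (hR : ∀ v ∈ siteBall R₀, |v.1| ≤ R ∧ |v.2| ≤ R) (hR0 : 0 ≤ R)
    {ω : Config} {α : Site → Bool} {T : Set Site} (hT : T.Finite) (hTω : T ⊆ enhanced φ ω α)
    {u e a b : Site} (hd : Dominates u e) (ha : a ∈ T) (hab : (openGraph T).Reachable a b)
    (hmin : ∀ v, (openGraph T).Reachable a v → lin u a ≤ lin u v)
    (hmax : ∀ v, (openGraph T).Reachable a v → lin u v ≤ lin u b)
    (hlt : lin u a + lin u e < lin u b) :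
    ∃ y z, ConnectedIn adjZ2 ω y z ∧ (|y.1 - a.1| ≤ 4 * R + 2 ∧ |y.2 - a.2| ≤ 4 * R + 2) ∧
      (|z.1 - b.1| ≤ 4 * R + 2 ∧ |z.2 - b.2| ≤ 4 * R + 2) := by
  set S : Set Site := {v | (openGraph T).Reachable a v} with hS
  have hST : S ⊆ T := fun v hv => mem_of_reachable hv ha
  have hSfin : S.Finite := hT.subset hST
  set F : Set Site := ω ∩ thicken (2 * R) S with hF
  have hFfin : F.Finite := (finite_thicken hSfin _).subset inter_subset_right
  set W : Set Site := F ∪ (ray a (-e) ∪ ray b e) with hW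
  have hunit : |(-e).1| + |(-e).2| = 1 := by simpa using hd.unit
  have hDISR : HasDISRPath adjZ2 W := by
    refine hasDISRPath_of_union_biUnion_enhAt hmono hness (finite_thicken hSfin R)
      ((hasDISRPath_of_reachable hd ha hab hmin hmax hlt).mono ?_)
    refine union_subset (fun v hv => ?_) fun v hv => Or.inl (Or.inr hv)
    rcases hTω (hST hv) with h | ⟨x, -, z, hz, hzv⟩
    · exact Or.inl (Or.inl ⟨h, v, hv, by simpa using hR0, by simpa using hR0⟩)
    · obtain rfl : z + x = v := hzv
      have hzR := hR z (hφ.2.1 _ hz)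
      refine Or.inr (mem_biUnion (x := x) ⟨z + x, hv, by simpa using hzR.1, by simpa using hzR.2⟩
        ⟨z, ?_, rfl⟩)
      have hloc : φ (shiftConfig x ω) = φ (shiftConfig x F) := by
        refine hφ.2.2 _ _ (Subset.antisymm ?_ ?_)
        · rintro y ⟨hy, hyb⟩
          have hyR := hR y hyb
          refine ⟨⟨hy, z + x, hv, ?_, ?_⟩, hyb⟩
          · rw [abs_le] at *
            dsimp
            constructor <;> linarith [hyR.1.1, hyR.1.2, hzR.1.1, hzR.1.2]
          · simp only [abs_le] at *
            dsimp
            constructor <;> linarith [hyR.2.1, hyR.2.2, hzR.2.1, hzR.2.2]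
        · rintro y ⟨hy, hyb⟩
          exact ⟨hy.1, hyb⟩
      rw [hloc] at hz
      exact hmono _ _ (fun y hy => Or.inl hy) hz
  have hray := fun {v w : Site} => lin_lt_of_mem_ray (v := v) (w := w) hd hlt
  obtain ⟨y, hy, z, hz, hyz, hya, hzb⟩ := exists_crossing_of_hasDISRPath hFfin hunit hd.unit
    (Set.disjoint_left.2 fun v hv hw => by have := hray hv hw; linarith [hd.pos])
    (fun v hv w hw hvw => by have := hray hv hw; have := hd.adj_le hvw.symm; linarith) hDISR
  refine ⟨y, z, connectedIn_of_reachable (hyz.mono (openGraph_mono inter_subset_left)) hy.1,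
    ?_, ?_⟩
  · have := close_of_adj_ray hd hmin hy.2 hya
    convert this using 2 <;> ring
  · have := close_of_adj_ray (a := b) hd.neg (S := S)
      (fun v hv => by have := hmax v hv; simp only [lin, Prod.fst_neg, Prod.snd_neg] at *; linarith)
      hz.2 (by simpa using hzb)
    convert this using 2 <;> ring

lemma exists_dominates (x : Site) : ∃ e : Site, Dominates (x + e) e := by
  have aux : ∀ e : Site, |e.1| + |e.2| = 1 →
      (∀ d : Site, (d = (1, 0) ∨ d = (-1, 0) ∨ d = (0, 1) ∨ d = (0, -1)) →
        d ≠ e → lin (x + e) d < lin (x + e) e) → Dominates (x + e) e := by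
    intro e he h
    refine ⟨he, fun d hd => h d ?_⟩
    obtain ⟨d1, d2⟩ := d
    simp only [Prod.mk.injEq]
    dsimp at hd
    rcases abs_cases d1 with h1 | h1 <;> rcases abs_cases d2 with h2 | h2 <;> omega
  rcases le_total |x.2| |x.1| with h | h
  · rw [abs_le] at h
    rcases abs_cases x.1 with ⟨h1, h0⟩ | ⟨h1, h0⟩ <;> rw [h1] at h <;> clear h1
    · refine ⟨(1, 0), aux _ (by simp) ?_⟩
      rintro d (rfl | rfl | rfl | rfl) hne <;> simp [lin] at * <;> omega
    · refine ⟨(-1, 0), aux _ (by simp) ?_⟩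
      rintro d (rfl | rfl | rfl | rfl) hne <;> simp [lin] at * <;> omega
  · rw [abs_le] at h
    rcases abs_cases x.2 with ⟨h1, h0⟩ | ⟨h1, h0⟩ <;> rw [h1] at h <;> clear h1
    · refine ⟨(0, 1), aux _ (by simp) ?_⟩
      rintro d (rfl | rfl | rfl | rfl) hne <;> simp [lin] at * <;> omega
    · refine ⟨(0, -1), aux _ (by simp) ?_⟩
      rintro d (rfl | rfl | rfl | rfl) hne <;> simp [lin] at * <;> omega

lemma siteNorm_eq_norm (x : Site) : siteNorm x = ‖(⟨x.1, x.2⟩ : ℂ)‖ := by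
  rw [Complex.norm_eq_sqrt_sq_add_sq, siteNorm]

lemma siteNorm_nonneg (x : Site) : 0 ≤ siteNorm x := Real.sqrt_nonneg _

lemma siteNorm_add_le (x y : Site) : siteNorm (x + y) ≤ siteNorm x + siteNorm y := by
  simp only [siteNorm_eq_norm]
  refine le_of_eq_of_le (congrArg _ ?_) (norm_add_le _ _)
  apply Complex.ext <;> simp

lemma siteNorm_neg (x : Site) : siteNorm (-x) = siteNorm x := by
  simp [siteNorm]

lemma siteNorm_sq (x : Site) : siteNorm x ^ 2 = (lin x x : ℤ) := by
  rw [siteNorm, Real.sq_sqrt (by positivity), lin]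
  push_cast
  ring

lemma siteNorm_le (x : Site) : siteNorm x ≤ ((|x.1| + |x.2| : ℤ) : ℝ) := by
  rw [siteNorm_eq_norm]
  refine (Complex.norm_le_abs_re_add_abs_im _).trans ?_
  simp

lemma abs_fst_le_siteNorm (x : Site) : |(x.1 : ℝ)| ≤ siteNorm x := by
  rw [siteNorm_eq_norm]
  exact Complex.abs_re_le_norm ⟨x.1, x.2⟩

lemma abs_snd_le_siteNorm (x : Site) : |(x.2 : ℝ)| ≤ siteNorm x := by
  rw [siteNorm_eq_norm]
  exact Complex.abs_im_le_norm ⟨x.1, x.2⟩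

lemma lin_le_siteNorm_mul (u w : Site) : (lin u w : ℝ) ≤ siteNorm u * siteNorm w := by
  rw [siteNorm, siteNorm, ← Real.sqrt_mul (by positivity)]
  apply Real.le_sqrt_of_sq_le
  rw [lin]
  push_cast
  nlinarith [sq_nonneg ((u.1 : ℝ) * w.2 - u.2 * w.1)]

/-- The sites of norm at most `N`, as a subset of a finite box. -/
noncomputable def boxFinset (N : ℝ) : Finset Site :=
  Finset.Icc (-⌊N⌋) ⌊N⌋ ×ˢ Finset.Icc (-⌊N⌋) ⌊N⌋

lemma mem_boxFinset {N : ℝ} {x : Site} (h : siteNorm x ≤ N) : x ∈ boxFinset N := by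
  have h1 := (abs_fst_le_siteNorm x).trans h
  have h2 := (abs_snd_le_siteNorm x).trans h
  rw [← Int.cast_abs] at h1 h2
  have h3 := abs_le.1 (Int.le_floor.2 h1)
  have h4 := abs_le.1 (Int.le_floor.2 h2)
  simp [boxFinset, h3, h4]

lemma card_boxFinset {N : ℝ} (hN : 0 ≤ N) : ((boxFinset N).card : ℝ) ≤ (2 * N + 1) ^ 2 := by
  have h0 : 0 ≤ ⌊N⌋ := Int.floor_nonneg.2 hN
  have hcast : (((⌊N⌋ + 1 - -⌊N⌋).toNat : ℕ) : ℝ) = 2 * ⌊N⌋ + 1 := by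
    have : (((⌊N⌋ + 1 - -⌊N⌋).toNat : ℤ) : ℝ) = ((2 * ⌊N⌋ + 1 : ℤ) : ℝ) := by
      congr 1
      omega
    push_cast at this
    exact this
  rw [boxFinset, Finset.card_product, Int.card_Icc, Nat.cast_mul, hcast, ← sq]
  have : (0 : ℝ) ≤ ⌊N⌋ := by exact_mod_cast h0
  gcongr
  exact Int.floor_le N

/-- A long connection in the enhanced configuration forces an almost equally long connection,
in the same region, in the original one. -/
lemma exists_connectedIn_of_enhanced {φ : Config → Config} {R₀ : ℝ} (hφ : IsEnhancement R₀ φ)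
    (hmono : Monotonic φ) (hness : ¬ Essential adjZ2 φ) :
    ∃ K : ℝ, 0 ≤ K ∧ ∀ (ω : Config) (α : Site → Bool) (x : Site), 2 ≤ siteNorm x →
      ConnectedIn adjZ2 (enhanced φ ω α) 0 x →
      ∃ y z, ConnectedIn adjZ2 ω y z ∧ siteNorm x - K ≤ siteNorm (z - y) ∧
        siteNorm y ≤ siteNorm x + K ∧ siteNorm z ≤ siteNorm x + K := by
  set R : ℤ := ⌊R₀⌋ with hRdef
  have hR0 : 0 ≤ R := Int.floor_nonneg.2 hφ.1
  have hR : ∀ v ∈ siteBall R₀, |v.1| ≤ R ∧ |v.2| ≤ R := by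
    intro v hv
    have h1 := (abs_fst_le_siteNorm v).trans hv
    have h2 := (abs_snd_le_siteNorm v).trans hv
    rw [← Int.cast_abs] at h1 h2
    exact ⟨Int.le_floor.2 h1, Int.le_floor.2 h2⟩
  have hR0' : (0 : ℝ) ≤ R := by exact_mod_cast hR0
  refine ⟨16 * R + 9, by positivity, fun ω α x hx hcon => ?_⟩
  set L := siteNorm x with hL
  set T : Set Site := enhanced φ ω α ∩ {v | siteNorm v ≤ L + 1} with hTdef
  have hT : T.Finite :=
    (boxFinset (L + 1)).finite_toSet.subset fun v hv => mem_boxFinset hv.2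
  obtain ⟨h0, hreach⟩ := hcon.reachable
  have h0T : (0 : Site) ∈ T := ⟨h0, by
    have : siteNorm 0 = 0 := by simp [siteNorm]
    rw [mem_ofPred_eq, this]
    linarith⟩
  obtain ⟨x', hx', hLx'⟩ : ∃ x', (openGraph T).Reachable 0 x' ∧ L ≤ siteNorm x' := by
    by_contra! hcon
    have key : ∀ v, (openGraph (enhanced φ ω α)).Reachable 0 v → (openGraph T).Reachable 0 v := by
      intro v hv
      rw [SimpleGraph.reachable_iff_reflTransGen] at hv
      induction hv with
      | refl => exact SimpleGraph.Reachable.refl _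
      | @tail v w _ hvw ih =>
        have hw : siteNorm w ≤ L + 1 := by
          have h1 := siteNorm_add_le v (w - v)
          rw [add_sub_cancel] at h1
          have h2 := siteNorm_le (w - v)
          have h3 : |(w - v).1| + |(w - v).2| = 1 := hvw.1.symm
          rw [h3, Int.cast_one] at h2
          linarith [hcon v ih]
        have hadj : (openGraph T).Adj v w :=
          ⟨hvw.1, mem_of_reachable ih h0T, hvw.2.2, hw⟩
        exact ih.trans hadj.reachable
    exact (hcon x (key x hreach)).false
  obtain ⟨e, hd⟩ := exists_dominates x'
  set u := x' + e with hu
  have hSfin : {v | (openGraph T).Reachable 0 v}.Finite :=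
    hT.subset fun v hv => mem_of_reachable hv h0T
  obtain ⟨a, ha, hmin⟩ := Set.exists_min_image _ (lin u) hSfin ⟨x', hx'⟩
  obtain ⟨b, hb, hmax⟩ := Set.exists_max_image _ (lin u) hSfin ⟨x', hx'⟩
  have h1 : lin u a ≤ 0 := by
    simpa [lin] using hmin 0 (SimpleGraph.Reachable.refl _)
  have h2 : lin x' x' + lin x' e ≤ lin u b := by
    refine le_trans (le_of_eq ?_) (hmax x' hx')
    simp [hu, lin]
    ring
  have hee : lin e e = 1 := by
    have hunit := hd.unit
    have h3 : |e.1| ≤ 1 := by linarith [abs_nonneg e.2]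
    have h4 : |e.2| ≤ 1 := by linarith [abs_nonneg e.1]
    rw [lin, ← sq, ← sq, ← sq_abs e.1, ← sq_abs e.2]
    have h5 := abs_nonneg e.1
    have h6 := abs_nonneg e.2
    generalize |e.1| = c at *
    generalize |e.2| = d at *
    obtain rfl : d = 1 - c := by omega
    interval_cases c <;> norm_num
  have h3 : lin u e = lin x' e + 1 := by
    rw [← hee]
    simp [hu, lin]
    ring
  have h4 : 1 < lin x' x' := by
    have h5 := siteNorm_sq x'
    have : (1 : ℝ) < (lin x' x' : ℤ) := by
      rw [← h5]
      nlinarith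
    exact_mod_cast this
  obtain ⟨y, z, hyz, ⟨hy1, hy2⟩, hz1, hz2⟩ := exists_connectedIn_near hφ hmono hness hR hR0 hT
    inter_subset_left hd (mem_of_reachable ha h0T) (ha.symm.trans hb)
    (fun v hv => hmin v (ha.trans hv)) (fun v hv => hmax v (ha.trans hv)) (by linarith)
  have hya : siteNorm (y - a) ≤ 8 * R + 4 := by
    refine (siteNorm_le _).trans ?_
    have : |(y - a).1| + |(y - a).2| ≤ 8 * R + 4 := by dsimp; linarith
    exact_mod_cast this
  have hzb : siteNorm (z - b) ≤ 8 * R + 4 := by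
    refine (siteNorm_le _).trans ?_
    have : |(z - b).1| + |(z - b).2| ≤ 8 * R + 4 := by dsimp; linarith
    exact_mod_cast this
  have haL : siteNorm a ≤ L + 1 := (mem_of_reachable ha h0T).2
  have hbL : siteNorm b ≤ L + 1 := (mem_of_reachable hb h0T).2
  have hba : L - 1 ≤ siteNorm (b - a) := by
    have h5 := lin_le_siteNorm_mul u (b - a)
    have h6 : siteNorm u ≤ siteNorm x' + 1 := by
      refine (siteNorm_add_le _ _).trans ?_
      have := siteNorm_le e
      rw [hd.unit, Int.cast_one] at this
      linarith
    have h7 : siteNorm x' ^ 2 ≤ (lin u (b - a) : ℝ) := by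
      rw [siteNorm_sq, lin_sub]
      have : lin x' x' ≤ lin u b - lin u a := by linarith [hd.pos]
      exact_mod_cast this
    have h8 := siteNorm_nonneg (b - a)
    have h9 := mul_le_mul_of_nonneg_right h6 h8
    by_contra! hc
    nlinarith
  refine ⟨y, z, hyz, ?_, ?_, ?_⟩
  · have h5 := siteNorm_add_le (z - y) ((y - a) + -(z - b))
    have h6 := siteNorm_add_le (y - a) (-(z - b))
    rw [siteNorm_neg] at h6
    rw [show z - y + ((y - a) + -(z - b)) = b - a by abel] at h5
    linarith
  · have h5 := siteNorm_add_le (y - a) a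
    rw [sub_add_cancel] at h5
    linarith
  · have h5 := siteNorm_add_le (z - b) b
    rw [sub_add_cancel] at h5
    linarith

lemma reachable_univ_line {e : Site} (he : |e.1| + |e.2| = 1) (a : Site) (k : ℤ) :
    (openGraph univ).Reachable a (a + k • e) := by
  have hstep : ∀ i : ℤ, (openGraph univ).Adj (a + i • e) (a + (i + 1) • e) :=
    fun i => ⟨(adjZ2_line he a _ _).2 (by simp), mem_univ _, mem_univ _⟩
  induction k with
  | zero => simp
  | succ n ih => exact ih.trans (hstep n).reachable
  | pred n ih =>
    have := hstep (-n - 1)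
    rw [sub_add_cancel] at this
    exact ih.trans this.reachable.symm

lemma connectedIn_univ (x : Site) : ConnectedIn adjZ2 univ 0 x := by
  refine connectedIn_of_reachable ?_ (mem_univ _)
  have h1 := reachable_univ_line (e := (1, 0)) (by simp) 0 x.1
  have h2 := reachable_univ_line (e := (0, 1)) (by simp) (0 + x.1 • (1, 0)) x.2
  convert h1.trans h2 using 1
  ext <;> simp

lemma ConnectedIn.mono {adj : Site → Site → Prop} {ω ω' : Config} (h : ω ⊆ ω') {x y : Site}
    (hxy : ConnectedIn adj ω x y) : ConnectedIn adj ω' x y := by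
  obtain ⟨l, h1, h2, h3⟩ := hxy
  exact ⟨l, h1, fun z hz => h (h2 z hz), h3⟩

lemma ConnectedIn.shift {ω : Config} {y z : Site} (h : ConnectedIn adjZ2 ω y z) :
    ConnectedIn adjZ2 (shiftConfig y ω) 0 (z - y) := by
  obtain ⟨l, ⟨h1, h2, h3⟩, h4, h5, h6⟩ := h
  refine ⟨l.map (· - y), ⟨by simpa using h1, h2.map (sub_left_injective), ?_⟩, ?_, ?_, ?_⟩
  · exact List.isChain_map_of_isChain _ (fun a b hab => by simpa [adjZ2] using hab) h3
  · intro w hw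
    obtain ⟨v, hv, rfl⟩ := List.mem_map.1 hw
    simpa [shiftConfig] using h4 v hv
  · simp [h5]
  · simp [List.getLast?_map, h6]

/-- A measure on configurations is determined by its values on cylinders. -/
lemma measure_ext_of_cylinder {μ ν : Measure (Site → Bool)} [IsProbabilityMeasure μ]
    [IsProbabilityMeasure ν] (h : ∀ F b, μ (cylinder F b) = ν (cylinder F b)) : μ = ν := by
  classical
  have hmeas : ∀ F b, MeasurableSet (cylinder F b) := by
    intro F b
    have : cylinder F b = ⋂ x ∈ F, (fun η : Site → Bool => η x) ⁻¹' {b x} := by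
      ext η
      simp [cylinder]
    rw [this]
    exact F.measurableSet_biInter fun x _ => measurable_pi_apply x (measurableSet_singleton _)
  refine ext_of_generate_finite {s | ∃ F b, s = cylinder F b} (le_antisymm ?_ ?_) ?_ ?_ (by simp)
  · refine iSup_le fun x => Measurable.comap_le ?_
    refine @measurable_to_countable' _ _ _ _ (MeasurableSpace.generateFrom _) _ fun b => ?_
    refine MeasurableSpace.measurableSet_generateFrom ⟨{x}, fun _ => b, ?_⟩
    ext η
    simp [cylinder]
  · refine MeasurableSpace.generateFrom_le ?_
    rintro _ ⟨F, b, rfl⟩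
    exact hmeas F b
  · rintro _ ⟨F, b, rfl⟩ _ ⟨G, c, rfl⟩ ⟨η, hη⟩
    refine ⟨F ∪ G, η, ?_⟩
    ext ζ
    simp only [cylinder, mem_inter_iff, mem_ofPred_eq, Finset.mem_union] at hη ⊢
    constructor
    · rintro ⟨h1, h2⟩ x (hx | hx)
      · rw [h1 x hx, hη.1 x hx]
      · rw [h2 x hx, hη.2 x hx]
    · intro h1
      exact ⟨fun x hx => by rw [h1 x (Or.inl hx), hη.1 x hx],
        fun x hx => by rw [h1 x (Or.inr hx), hη.2 x hx]⟩
  · rintro _ ⟨F, b, rfl⟩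
    exact h F b

/-- The translation of configurations, as a measurable equivalence. -/
def shiftEquiv (y : Site) : (Site → Bool) ≃ᵐ (Site → Bool) where
  toFun η v := η (v + y)
  invFun η v := η (v - y)
  left_inv η := by ext v; simp
  right_inv η := by ext v; simp
  measurable_toFun := measurable_pi_lambda _ fun v => measurable_pi_apply (v + y)
  measurable_invFun := measurable_pi_lambda _ fun v => measurable_pi_apply (v - y)

lemma IsBernoulli.map_shiftEquiv {p : ℝ} {μ : Measure (Site → Bool)} (h : IsBernoulli p μ)
    (y : Site) : μ.map (shiftEquiv y) = μ := by
  have := h.1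
  have : IsProbabilityMeasure (μ.map (shiftEquiv y)) :=
    Measure.isProbabilityMeasure_map (shiftEquiv y).measurable.aemeasurable
  refine measure_ext_of_cylinder fun F b => ?_
  rw [(shiftEquiv y).map_apply]
  have hpre : shiftEquiv y ⁻¹' cylinder F b =
      cylinder (F.map (addRightEmbedding y)) (fun v => b (v - y)) := by
    ext η
    simp only [cylinder, shiftEquiv, mem_preimage, mem_ofPred_eq, Finset.forall_mem_map,
      addRightEmbedding_apply, add_sub_cancel_right]
    rfl
  rw [hpre, h.2, h.2, Finset.prod_map]
  simp

lemma IsBernoulli.measure_connectedIn_le {p : ℝ} {μ : Measure (Site → Bool)}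
    (h : IsBernoulli p μ) (y z : Site) :
    (μ {η | ConnectedIn adjZ2 (toConfig η) y z}).toReal ≤ tau adjZ2 μ (z - y) := by
  have := h.1
  refine ENNReal.toReal_mono (measure_ne_top _ _) ?_
  conv_rhs => rw [← h.map_shiftEquiv y, (shiftEquiv y).map_apply]
  exact measure_mono fun η hη => ConnectedIn.shift hη

lemma IsBernoulli.tau_pos {p : ℝ} {μ : Measure (Site → Bool)} (h : IsBernoulli p μ) (hp : 0 < p)
    (x : Site) : 0 < tau adjZ2 μ x := by
  classical
  have := h.1
  obtain ⟨l, hl, -, hl'⟩ := connectedIn_univ x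
  refine ENNReal.toReal_pos (ne_of_gt (lt_of_lt_of_le ?_
    (measure_mono (s := cylinder l.toFinset fun _ => true) ?_))) (measure_ne_top _ _)
  · rw [h.2]
    exact CanonicallyOrderedAdd.prod_pos.2 fun _ _ => by simpa using hp
  · intro η hη
    exact ⟨l, hl, fun z hz => hη z (List.mem_toFinset.2 hz), hl'⟩

lemma tau_le_one {μ : Measure (Site → Bool)} [IsProbabilityMeasure μ] (x : Site) :
    tau adjZ2 μ x ≤ 1 := ENNReal.toReal_le_of_le_ofReal zero_le_one (by simpa using prob_le_one)

lemma tau_le_tauEnh (φ : Config → Config) {μ ν : Measure (Site → Bool)} [IsProbabilityMeasure μ]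
    [IsProbabilityMeasure ν] (x : Site) : tau adjZ2 μ x ≤ tauEnh adjZ2 φ μ ν x := by
  refine ENNReal.toReal_mono (measure_ne_top _ _) ?_
  calc μ {η | ConnectedIn adjZ2 (toConfig η) 0 x}
      = (μ.prod ν) ({η | ConnectedIn adjZ2 (toConfig η) 0 x} ×ˢ univ) := by
        rw [Measure.prod_prod, measure_univ, mul_one]
    _ ≤ _ := measure_mono fun ηα h => ConnectedIn.mono subset_union_left h.1

/-- The enhanced connectivity function is bounded by a polynomial number of terms of the original
connectivity function at almost the same distance. -/
lemma exists_tauEnh_le {φ : Config → Config} {R₀ : ℝ} (hφ : IsEnhancement R₀ φ)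
    (hmono : Monotonic φ) (hness : ¬ Essential adjZ2 φ) {p : ℝ} {μ ν : Measure (Site → Bool)}
    (hμ : IsBernoulli p μ) [IsProbabilityMeasure ν] :
    ∃ K : ℝ, 0 ≤ K ∧ ∀ (x : Site) (t : ℝ), 2 ≤ siteNorm x → 0 ≤ t →
      (∀ w, siteNorm x - K ≤ siteNorm w → siteNorm w ≤ 2 * (siteNorm x + K) → tau adjZ2 μ w ≤ t) →
      tauEnh adjZ2 φ μ ν x ≤ (2 * (siteNorm x + K) + 1) ^ 4 * t := by
  classical
  have := hμ.1
  obtain ⟨K, hK, hdet⟩ := exists_connectedIn_of_enhanced hφ hmono hness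
  refine ⟨K, hK, fun x t hx ht hw => ?_⟩
  set B := boxFinset (siteNorm x + K)
  set Q := (B ×ˢ B).filter fun q => siteNorm x - K ≤ siteNorm (q.2 - q.1) ∧
    siteNorm (q.2 - q.1) ≤ 2 * (siteNorm x + K) with hQ
  have hle : (μ.prod ν) {ηα | ConnectedIn adjZ2 (enhanced φ (toConfig ηα.1) ηα.2) 0 x} ≤
      ∑ q ∈ Q, μ {η | ConnectedIn adjZ2 (toConfig η) q.1 q.2} := by
    calc _ ≤ (μ.prod ν) ((⋃ q ∈ Q, {η | ConnectedIn adjZ2 (toConfig η) q.1 q.2}) ×ˢ univ) := by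
          refine measure_mono fun ηα h => ⟨?_, mem_univ _⟩
          obtain ⟨y, z, hyz, h1, h2, h3⟩ := hdet _ _ x hx h
          have h4 := siteNorm_add_le z (-y)
          rw [siteNorm_neg, ← sub_eq_add_neg] at h4
          refine mem_biUnion (x := (y, z)) ?_ hyz
          simp only [hQ, Finset.coe_filter, Finset.mem_product, mem_ofPred_eq]
          exact ⟨⟨mem_boxFinset h2, mem_boxFinset h3⟩, h1, by linarith⟩
      _ = μ (⋃ q ∈ Q, {η | ConnectedIn adjZ2 (toConfig η) q.1 q.2}) := by
          rw [Measure.prod_prod, measure_univ, mul_one]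
      _ ≤ _ := measure_biUnion_finset_le _ _
  calc tauEnh adjZ2 φ μ ν x
      ≤ (∑ q ∈ Q, μ {η | ConnectedIn adjZ2 (toConfig η) q.1 q.2}).toReal :=
        ENNReal.toReal_mono (ENNReal.sum_ne_top.2 fun _ _ => measure_ne_top _ _) hle
    _ = ∑ q ∈ Q, (μ {η | ConnectedIn adjZ2 (toConfig η) q.1 q.2}).toReal :=
        ENNReal.toReal_sum fun _ _ => measure_ne_top _ _
    _ ≤ ∑ q ∈ Q, t := by
        refine Finset.sum_le_sum fun q hq => (hμ.measure_connectedIn_le q.1 q.2).trans ?_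
        have := (Finset.mem_filter.1 hq).2
        exact hw _ this.1 this.2
    _ = Q.card * t := by simp
    _ ≤ (B.card * B.card : ℝ) * t := by
        refine mul_le_mul_of_nonneg_right ?_ ht
        have := Finset.card_filter_le (B ×ˢ B) fun q => siteNorm x - K ≤ siteNorm (q.2 - q.1) ∧
          siteNorm (q.2 - q.1) ≤ 2 * (siteNorm x + K)
        rw [Finset.card_product] at this
        exact_mod_cast this
    _ ≤ (2 * (siteNorm x + K) + 1) ^ 4 * t := by
        refine mul_le_mul_of_nonneg_right ?_ ht
        have := card_boxFinset (N := siteNorm x + K) (by linarith)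
        calc (B.card * B.card : ℝ) ≤ _ := mul_le_mul this this (by positivity) (by positivity)
          _ = _ := by ring

lemma pcOf_le_one (P : ℝ → Measure (Site → Bool)) : pcOf adjZ2 P ≤ 1 :=
  Real.sSup_le (fun _ hp => hp.1.2) zero_le_one

/-- Logarithmic terms are eventually dominated by linear ones. -/
lemma eventually_log_add_lt {δ c K : ℝ} (hδ : 0 < δ) :
    ∀ᶠ L : ℝ in atTop, 4 * Real.log (2 * (L + K) + 1) + c < δ * L := by
  have h1 : Tendsto (fun L : ℝ => 2 * (L + K) + 1) atTop atTop :=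
    tendsto_atTop_add_const_right _ _
      ((tendsto_atTop_add_const_right _ _ tendsto_id).const_mul_atTop two_pos)
  have h2 := h1.eventually (Real.isLittleO_log_id_atTop.bound (show 0 < δ / 16 by positivity))
  filter_upwards [h2, eventually_gt_atTop ((|2 * K + 1| * δ / 4 + |c|) * 2 / δ),
    eventually_ge_atTop 0] with L hL hL' hL0
  simp only [id, Real.norm_eq_abs] at hL
  have h3 := (le_abs_self _).trans hL
  have h4 : |2 * (L + K) + 1| ≤ 2 * L + |2 * K + 1| := by
    rw [show 2 * (L + K) + 1 = 2 * L + (2 * K + 1) by ring]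
    refine (abs_add_le _ _).trans ?_
    rw [abs_of_nonneg (by positivity : 0 ≤ 2 * L)]
  have h5 := mul_le_mul_of_nonneg_left h4 (show 0 ≤ δ / 16 by positivity)
  rw [div_lt_iff₀ hδ] at hL'
  have h6 := le_abs_self c
  nlinarith

/-- for a monotonic nonessential enhancement, `s ∈ [0,1]` and
`p ∈ (0, p_c]`, if the inverse correlation length
`ξ(p)⁻¹ = lim_{|x|→∞} (−log τ_p(x) / |x|)` exists, then the corresponding limit for
the enhanced process exists and equals it: `ξ(p,s) = ξ(p)`. -/
theorem correlation_length_unchanged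
    (P : ℝ → Measure (Site → Bool))
    (hP : ∀ p ∈ Icc (0:ℝ) 1, IsBernoulli p (P p))
    (R₀ : ℝ) (φ : Config → Config) (hφ : IsEnhancement R₀ φ)
    (hmono : Monotonic φ) (hness : ¬ Essential adjZ2 φ)
    (s : ℝ) (hs : s ∈ Icc (0:ℝ) 1)
    (p : ℝ) (hp0 : 0 < p) (hppc : p ≤ pcOf adjZ2 P)
    (ξinv : ℝ)
    (hlim : Tendsto (fun x : Site => -Real.log (tau adjZ2 (P p) x) / siteNorm x)
      (comap siteNorm atTop) (𝓝 ξinv)) :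
    Tendsto (fun x : Site => -Real.log (tauEnh adjZ2 φ (P p) (P s) x) / siteNorm x)
      (comap siteNorm atTop) (𝓝 ξinv) := by
  have hp : p ∈ Icc (0 : ℝ) 1 := ⟨hp0.le, hppc.trans (pcOf_le_one P)⟩
  have hμ := hP p hp
  have := hμ.1
  have := (hP s hs).1
  obtain ⟨K, hK, hbound⟩ := exists_tauEnh_le (ν := P s) hφ hmono hness hμ
  have hnorm : Tendsto siteNorm (comap siteNorm atTop) atTop := tendsto_comap
  rw [tendsto_order] at hlim ⊢
  refine ⟨fun c hc => ?_, fun c hc => ?_⟩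
  · set δ := (ξinv - c) / 4 with hδdef
    have hδ : 0 < δ := by rw [hδdef]; linarith
    have h1 := hlim.1 (ξinv - δ) (by linarith)
    rw [eventually_comap, eventually_atTop] at h1
    obtain ⟨M, hM⟩ := h1
    filter_upwards [hnorm.eventually (eventually_ge_atTop (max 2 (max (M + K) (K + 1)))),
      hnorm.eventually (eventually_log_add_lt (δ := δ) (c := |ξinv| * K + 2 * δ * K) (K := K) hδ)]
      with x hx hlog
    set L := siteNorm x with hL
    have hL2 : 2 ≤ L := (le_max_left _ _).trans hx
    have hLM : M + K ≤ L := ((le_max_left _ _).trans (le_max_right _ _)).trans hx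
    have hLK : K + 1 ≤ L := ((le_max_right _ _).trans (le_max_right _ _)).trans hx
    set A := -ξinv * L + |ξinv| * K + 2 * δ * (L + K) with hA
    have htau : tauEnh adjZ2 φ (P p) (P s) x ≤ (2 * (L + K) + 1) ^ 4 * Real.exp A := by
      refine hbound x _ hL2 (Real.exp_pos _).le fun w hw1 hw2 => ?_
      have hwpos : 0 < siteNorm w := by linarith
      have h2 := hM (siteNorm w) (by linarith) w rfl
      have hτ := hμ.tau_pos hp0 w
      rw [lt_div_iff₀ hwpos] at h2
      rw [← Real.log_le_iff_le_exp hτ]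
      have hlog0 : Real.log (tau adjZ2 (P p) w) ≤ 0 := Real.log_nonpos hτ.le (tau_le_one w)
      have h4 : δ * siteNorm w ≤ δ * (2 * (L + K)) := mul_le_mul_of_nonneg_left hw2 hδ.le
      rcases le_or_gt 0 ξinv with h | h
      · have h3 : ξinv * (L - K) ≤ ξinv * siteNorm w := mul_le_mul_of_nonneg_left hw1 h
        rw [hA, abs_of_nonneg h]
        linarith
      · have h3 : ξinv * L ≤ 0 := mul_nonpos_of_nonpos_of_nonneg h.le (by linarith)
        have h5 : 0 ≤ |ξinv| * K := by positivity
        have h6 : 0 ≤ δ * (L + K) := mul_nonneg hδ.le (by linarith)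
        rw [hA]
        linarith
    have hpos : 0 < tauEnh adjZ2 φ (P p) (P s) x :=
      (hμ.tau_pos hp0 x).trans_le (tau_le_tauEnh φ x)
    have h3 := Real.log_le_log hpos htau
    have h4 : 0 < 2 * (L + K) + 1 := by linarith
    rw [Real.log_mul (by positivity) (Real.exp_pos _).ne', Real.log_exp, Real.log_pow] at h3
    push_cast at h3
    rw [lt_div_iff₀ (by linarith), show c = ξinv - 4 * δ by rw [hδdef]; ring]
    have h5 : 0 < δ * L := mul_pos hδ (by linarith)
    linarith
  · filter_upwards [hlim.2 c hc] with x hx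
    refine lt_of_le_of_lt ?_ hx
    have := Real.log_le_log (hμ.tau_pos hp0 x) (tau_le_tauEnh φ (ν := P s) x)
    exact div_le_div_of_nonneg_right (by linarith) (siteNorm_nonneg x)

end PercEnh
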